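/- arXiv:2202.04167 — 2 statements merged into one kernel-verified Lean document; each statement's English description precedes it below -/
import Mathlib

section
/- Let X and Y be independent S-valued random variables and suppose z₀ ∈ S satisfies ∇F(z₀) = E[∇F(X)]. Then the expected loss decomposes into Bayes error, bias, and variance: E[D_F(Y, X)] = E[D_F(Y, E[Y])] + D_F(E[Y], z₀) + E[D_F(z₀, X)]. -/
open MeasureTheory ProbabilityTheory
open scoped RealInnerProductSpace

/-- The Bregman divergence `D_F(y, x) = F y - F x - ⟪∇F x, y - x⟫`. -/
noncomputable def bregmanDiv {E : Type*} [NormedAddCommGroup E] [InnerProductSpace ℝ E]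
    (F : E → ℝ) (f' : E → E) (y x : E) : ℝ :=
  F y - F x - ⟪f' x, y - x⟫

/-- The expectation of the inner product of two independent integrable random vectors is the inner
product of their expectations. -/
theorem integral_inner_of_indepFun
    {E : Type*} [NormedAddCommGroup E] [InnerProductSpace ℝ E] [CompleteSpace E]
    [MeasurableSpace E] [BorelSpace E] {Ω : Type*} [MeasurableSpace Ω] {μ : Measure Ω}
    [IsProbabilityMeasure μ] {U V : Ω → E} (hindep : IndepFun U V μ)
    (hU : Integrable U μ) (hV : Integrable V μ) :
    ∫ ω, ⟪U ω, V ω⟫ ∂μ = ⟪∫ ω, U ω ∂μ, ∫ ω, V ω ∂μ⟫ :=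
  hindep.integral_bilin hU hV (innerSL ℝ)

/-- The expected Bregman divergence between two integrable random vectors, term by term. -/
theorem integral_bregmanDiv
    {E : Type*} [NormedAddCommGroup E] [InnerProductSpace ℝ E]
    {Ω : Type*} [MeasurableSpace Ω] {μ : Measure Ω} {F : E → ℝ} {f' : E → E} {U V : Ω → E}
    (hFU : Integrable (fun ω => F (U ω)) μ) (hFV : Integrable (fun ω => F (V ω)) μ)
    (hVU : Integrable (fun ω => ⟪f' (V ω), U ω⟫) μ)
    (hVV : Integrable (fun ω => ⟪f' (V ω), V ω⟫) μ) :
    ∫ ω, bregmanDiv F f' (U ω) (V ω) ∂μ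
      = (∫ ω, F (U ω) ∂μ) - (∫ ω, F (V ω) ∂μ)
        - ((∫ ω, ⟪f' (V ω), U ω⟫ ∂μ) - ∫ ω, ⟪f' (V ω), V ω⟫ ∂μ) := by
  simp only [bregmanDiv, inner_sub_right]
  rw [integral_sub (by exact hFU.sub hFV) (by exact hVU.sub hVV), integral_sub hFU hFV,
    integral_sub hVU hVV]

/-- bias-variance decomposition. For independent `X, Y` and `z₀ ∈ S`
with `∇F(z₀) = E[∇F(X)]`,
`E[D_F(Y, X)] = E[D_F(Y, E[Y])] + D_F(E[Y], z₀) + E[D_F(z₀, X)]`. -/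
theorem bias_variance_decomposition
    {E : Type*} [NormedAddCommGroup E] [InnerProductSpace ℝ E] [CompleteSpace E]
    [MeasurableSpace E] [BorelSpace E]
    {Ω : Type*} [MeasurableSpace Ω] (μ : Measure Ω) [IsProbabilityMeasure μ]
    (S : Set E) (hS : Convex ℝ S) (F : E → ℝ) (f' : E → E)
    (hF : StrictConvexOn ℝ S F) (hdiff : ∀ x ∈ S, HasGradientAt F (f' x) x)
    (hf'meas : Measurable f')
    (X Y : Ω → E) (hXm : Measurable X) (hYm : Measurable Y)
    (hXS : ∀ ω, X ω ∈ S) (hYS : ∀ ω, Y ω ∈ S)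
    (hindep : IndepFun X Y μ)
    (hXint : Integrable X μ) (hYint : Integrable Y μ)
    (hFX : Integrable (fun ω => F (X ω)) μ)
    (hFY : Integrable (fun ω => F (Y ω)) μ)
    (hf'X : Integrable (fun ω => f' (X ω)) μ)
    (hXX : Integrable (fun ω => ⟪f' (X ω), X ω⟫) μ)
    (hXY : Integrable (fun ω => ⟪f' (X ω), Y ω⟫) μ)
    (hEY : (∫ ω, Y ω ∂μ) ∈ S)
    (z₀ : E) (hz₀S : z₀ ∈ S) (hz₀ : f' z₀ = ∫ ω, f' (X ω) ∂μ) :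
    ∫ ω, bregmanDiv F f' (Y ω) (X ω) ∂μ
      = (∫ ω, bregmanDiv F f' (Y ω) (∫ ω', Y ω' ∂μ) ∂μ)
        + bregmanDiv F f' (∫ ω', Y ω' ∂μ) z₀
        + ∫ ω, bregmanDiv F f' z₀ (X ω) ∂μ := by
  have hcross : ∫ ω, ⟪f' (X ω), Y ω⟫ ∂μ = ⟪f' z₀, ∫ ω, Y ω ∂μ⟫ := by
    rw [hz₀]
    exact integral_inner_of_indepFun (hindep.comp hf'meas measurable_id) hf'X hYint
  have hXz : ∫ ω, ⟪f' (X ω), z₀⟫ ∂μ = ⟪f' z₀, z₀⟫ := by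
    simp_rw [real_inner_comm z₀, integral_inner hf'X, ← hz₀]
  have hmY (m : E) : ∫ ω, ⟪m, Y ω⟫ ∂μ = ⟪m, ∫ ω, Y ω ∂μ⟫ := integral_inner hYint m
  rw [integral_bregmanDiv hFY hFX hXY hXX,
    integral_bregmanDiv (V := fun _ => ∫ ω', Y ω' ∂μ) hFY (integrable_const _)
      (hYint.const_inner _) (integrable_const _),
    integral_bregmanDiv (U := fun _ => z₀) (integrable_const _) hFX (hf'X.inner_const _) hXX,
    hcross, hXz, hmY, bregmanDiv, inner_sub_right]
  simp only [integral_const, probReal_univ, one_smul]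
  ring
end

section
/- If the primal variance vanishes, i.e. E[D_F(X, E[X])] = 0, then X = E[X] almost surely. -/
open MeasureTheory
open scoped RealInnerProductSpace

/-- A strictly convex function restricted to a nondegenerate segment is strictly convex. -/
theorem StrictConvexOn.comp_lineMap {E : Type*} [AddCommGroup E] [Module ℝ E]
    {S : Set E} {F : E → ℝ} (hF : StrictConvexOn ℝ S F) {x y : E} (hx : x ∈ S) (hy : y ∈ S)
    (hxy : x ≠ y) :
    StrictConvexOn ℝ (Set.Icc 0 1) fun t : ℝ => F (AffineMap.lineMap x y t) := by
  refine ⟨convex_Icc 0 1, fun s hs t ht hst a b ha hb hab => ?_⟩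
  have hmem : ∀ u ∈ Set.Icc (0 : ℝ) 1, AffineMap.lineMap x y u ∈ S :=
    fun u hu => hF.1.lineMap_mem hx hy hu
  have hne : AffineMap.lineMap x y s ≠ AffineMap.lineMap x y t :=
    fun h => hst (AffineMap.lineMap_injective ℝ hxy h)
  have h := hF.2 (hmem s hs) (hmem t ht) hne ha hb hab
  rwa [← Convex.combo_affine_apply hab] at h

/-- The Bregman divergence of a strictly convex function is positive off the diagonal. -/
theorem bregmanDiv_pos {E : Type*} [NormedAddCommGroup E] [InnerProductSpace ℝ E]
    [CompleteSpace E] {S : Set E} {F : E → ℝ} {f' : E → E} (hF : StrictConvexOn ℝ S F)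
    {x y : E} (hx : x ∈ S) (hy : y ∈ S) (hxy : x ≠ y) (hdiff : HasGradientAt F (f' x) x) :
    0 < bregmanDiv F f' y x := by
  have hderiv : HasDerivAt (fun t : ℝ => F (AffineMap.lineMap x y t)) ⟪f' x, y - x⟫ 0 := by
    have hd : HasFDerivAt F (InnerProductSpace.toDual ℝ E (f' x))
        (AffineMap.lineMap x y (0 : ℝ)) := by
      simpa using hdiff.hasFDerivAt
    exact hd.comp_hasDerivAt (0 : ℝ) AffineMap.hasDerivAt_lineMap
  have h := (hF.comp_lineMap hx hy hxy).lt_slope_of_hasDerivAt (x := 0) (y := 1)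
    (by simp) (by simp) one_pos hderiv
  simp only [slope_def_field, AffineMap.lineMap_apply_one, AffineMap.lineMap_apply_zero, sub_zero,
    div_one] at h
  unfold bregmanDiv
  linarith

/-- if the primal variance vanishes, `E[D_F(X, E[X])] = 0`, then
`X = E[X]` almost surely. -/
theorem primal_variance_eq_zero
    {E : Type*} [NormedAddCommGroup E] [InnerProductSpace ℝ E] [CompleteSpace E]
    {Ω : Type*} [MeasurableSpace Ω] (μ : Measure Ω) [IsProbabilityMeasure μ]
    (S : Set E) (hS : Convex ℝ S) (F : E → ℝ) (f' : E → E)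
    (hF : StrictConvexOn ℝ S F) (hdiff : ∀ x ∈ S, HasGradientAt F (f' x) x)
    (X : Ω → E) (hXS : ∀ ω, X ω ∈ S)
    (hXint : Integrable X μ)
    (hFX : Integrable (fun ω => F (X ω)) μ)
    (hEX : (∫ ω, X ω ∂μ) ∈ S)
    (hvar : ∫ ω, bregmanDiv F f' (X ω) (∫ ω', X ω' ∂μ) ∂μ = 0) :
    ∀ᵐ ω ∂μ, X ω = ∫ ω', X ω' ∂μ := by
  set m := ∫ ω, X ω ∂μ with hm
  have hpos : ∀ ω, X ω ≠ m → 0 < bregmanDiv F f' (X ω) m :=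
    fun ω h => bregmanDiv_pos hF hEX (hXS ω) h.symm (hdiff m hEX)
  have hnonneg : ∀ ω, 0 ≤ bregmanDiv F f' (X ω) m := by
    intro ω
    by_cases h : X ω = m
    · simp [h, bregmanDiv]
    · exact (hpos ω h).le
  have hint : Integrable (fun ω => bregmanDiv F f' (X ω) m) μ :=
    (hFX.sub (integrable_const _)).sub ((hXint.sub (integrable_const m)).const_inner (f' m))
  filter_upwards [(integral_eq_zero_iff_of_nonneg hnonneg hint).1 hvar] with ω hω
  by_contra h
  exact (hpos ω h).ne' hω
end
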